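/- Let u : [0,1] → (d×d real matrices) be a continuous path such that u(t) is upper triangular unipotent for every t ∈ [0,1]. Suppose u(0) is totally positive, and suppose that for every t ∈ [0,1] and every k with 1 ≤ k ≤ d−1 the top-right corner k×k minor of u(t) is nonzero, i.e. det(u(t).submatrix I₀ J₀) ≠ 0 where I₀ = (0, …, k−1) and J₀ = (d−k, …, d−1) (0-indexed). Then u(1) is totally positive. -/

import Mathlib

open Matrix

/-- An upper triangular unipotent `d × d` real matrix: all entries below the
diagonal vanish and all diagonal entries equal `1`. -/
def UTUnipotent {d : ℕ} (u : Matrix (Fin d) (Fin d) ℝ) : Prop :=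
  (∀ i j : Fin d, (j : ℕ) < (i : ℕ) → u i j = 0) ∧ ∀ i : Fin d, u i i = 1

/-- A (square, upper triangular unipotent) matrix is totally positive if all of
its non-trivial minors are positive: for all strictly increasing index tuples
`I J : Fin k → Fin d` with `I p ≤ J p` for all `p`, the corresponding minor is
positive. -/
def TotallyPositive {d : ℕ} (u : Matrix (Fin d) (Fin d) ℝ) : Prop :=
  ∀ k : ℕ, 1 ≤ k → k ≤ d → ∀ I J : Fin k → Fin d,
    StrictMono I → StrictMono J → (∀ p, I p ≤ J p) → 0 < (u.submatrix I J).det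

/-- A (square, upper triangular unipotent) matrix is totally nonnegative if all
of its non-trivial minors are nonnegative. -/
def TotallyNonneg {d : ℕ} (u : Matrix (Fin d) (Fin d) ℝ) : Prop :=
  ∀ k : ℕ, 1 ≤ k → k ≤ d → ∀ I J : Fin k → Fin d,
    StrictMono I → StrictMono J → (∀ p, I p ≤ J p) → 0 ≤ (u.submatrix I J).det

/-- The `d`-th upper triangular Pascal matrix: its `(i,j)` entry (`0`-indexed)
is `C(j,i)` when `i ≤ j` and `0` otherwise. -/
def pascal (d : ℕ) : Matrix (Fin d) (Fin d) ℝ :=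
  Matrix.of fun i j => if (i : ℕ) ≤ (j : ℕ) then ((j : ℕ).choose (i : ℕ) : ℝ) else 0

/-- A tuple `I : Fin k → Fin d` is consecutive if `I p = I 0 + p` for all `p`
(stated symmetrically so that it also makes sense for `k = 0`). -/
def Consecutive {d k : ℕ} (I : Fin k → Fin d) : Prop :=
  ∀ p q : Fin k, (I p : ℕ) + (q : ℕ) = (I q : ℕ) + (p : ℕ)

/-- The row indices `(0, 1, …, k-1)` of the top-right corner `k × k` minor. -/
def cornerI {d : ℕ} (k : ℕ) (hk : k ≤ d) : Fin k → Fin d :=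
  fun p => ⟨(p : ℕ), lt_of_lt_of_le p.isLt hk⟩

/-- The column indices `(d-k, d-k+1, …, d-1)` of the top-right corner `k × k`
minor. -/
def cornerJ {d : ℕ} (k : ℕ) (hk : k ≤ d) : Fin k → Fin d :=
  fun p => ⟨d - k + (p : ℕ), by have h := p.isLt; omega⟩

namespace TotalPositivity

/-- All minors of a matrix, indexed by strictly increasing tuples, are nonnegative. -/
def MinorsNonneg {m n : ℕ} (A : Matrix (Fin m) (Fin n) ℝ) : Prop :=
  ∀ (k : ℕ) (I : Fin k → Fin m) (J : Fin k → Fin n),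
    StrictMono I → StrictMono J → 0 ≤ (A.submatrix I J).det

lemma MinorsNonneg.submatrix {m n m' n' : ℕ} {A : Matrix (Fin m) (Fin n) ℝ}
    (hA : MinorsNonneg A) {f : Fin m' → Fin m} {g : Fin n' → Fin n}
    (hf : StrictMono f) (hg : StrictMono g) : MinorsNonneg (A.submatrix f g) := by
  intro k I J hI hJ
  rw [submatrix_submatrix]
  exact hA k _ _ (hf.comp hI) (hg.comp hJ)

lemma strictMono_rev_conj {k n : ℕ} {I : Fin k → Fin n} (hI : StrictMono I) :
    StrictMono (Fin.rev ∘ I ∘ Fin.rev) :=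
  fun _ _ h => Fin.rev_lt_rev.mpr (hI (Fin.rev_lt_rev.mpr h))

lemma det_submatrix_rev {m n k : ℕ} (A : Matrix (Fin m) (Fin n) ℝ)
    (I : Fin k → Fin m) (J : Fin k → Fin n) :
    ((A.submatrix Fin.rev Fin.rev).submatrix I J).det =
      (A.submatrix (Fin.rev ∘ I ∘ Fin.rev) (Fin.rev ∘ J ∘ Fin.rev)).det := by
  rw [← det_submatrix_equiv_self Fin.revPerm]
  rfl

lemma MinorsNonneg.rev {m n : ℕ} {A : Matrix (Fin m) (Fin n) ℝ}
    (hA : MinorsNonneg A) : MinorsNonneg (A.submatrix Fin.rev Fin.rev) := by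
  intro k I J hI hJ
  rw [det_submatrix_rev]
  exact hA k _ _ (strictMono_rev_conj hI) (strictMono_rev_conj hJ)

lemma MinorsNonneg.transpose {m n : ℕ} {A : Matrix (Fin m) (Fin n) ℝ}
    (hA : MinorsNonneg A) : MinorsNonneg Aᵀ := by
  intro k I J hI hJ
  rw [← transpose_submatrix, det_transpose]
  exact hA k _ _ hJ hI

lemma MinorsNonneg.entry_nonneg {m n : ℕ} {A : Matrix (Fin m) (Fin n) ℝ}
    (hA : MinorsNonneg A) (i : Fin m) (j : Fin n) : 0 ≤ A i j := by
  have h := hA 1 (fun _ => i) (fun _ => j) (Subsingleton.strictMono _) (Subsingleton.strictMono _)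
  simpa using h

/-- The Schur complement of the top left entry. -/
noncomputable def schurZero {m n : ℕ} (A : Matrix (Fin (m + 1)) (Fin (n + 1)) ℝ) :
    Matrix (Fin m) (Fin n) ℝ :=
  of fun i j => A i.succ j.succ - A i.succ 0 / A 0 0 * A 0 j.succ

lemma det_eq_mul_det_schurZero {n : ℕ} (A : Matrix (Fin (n + 1)) (Fin (n + 1)) ℝ)
    (h : A 0 0 ≠ 0) : A.det = A 0 0 * (schurZero A).det := by
  have key : A.det = (of (Fin.cons (A 0) fun (i : Fin n) j =>
      A i.succ j - A i.succ 0 / A 0 0 * A 0 j) : Matrix (Fin (n + 1)) (Fin (n + 1)) ℝ).det := by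
    refine det_eq_of_forall_row_eq_smul_add_const
      (Fin.cons 0 fun i : Fin n => A i.succ 0 / A 0 0) 0 (by simp) ?_
    intro i j
    refine Fin.cases ?_ (fun i => ?_) i <;> simp
  rw [key, det_succ_column_zero, Fin.sum_univ_succ, Finset.sum_eq_zero]
  · simp only [Fin.val_zero, pow_zero, one_mul, of_apply, Fin.cons_zero, add_zero]
    congr 2
  · intro i _
    simp [h]

lemma det_submatrix_schurZero {m n k : ℕ} (A : Matrix (Fin (m + 1)) (Fin (n + 1)) ℝ)
    (h : A 0 0 ≠ 0) (I : Fin k → Fin m) (J : Fin k → Fin n) :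
    (A.submatrix (Fin.cons 0 (Fin.succ ∘ I) : Fin (k + 1) → Fin (m + 1))
      (Fin.cons 0 (Fin.succ ∘ J) : Fin (k + 1) → Fin (n + 1))).det =
      A 0 0 * ((schurZero A).submatrix I J).det := by
  rw [det_eq_mul_det_schurZero _ (by simpa using h)]
  rfl

lemma strictMono_cons_zero {k n : ℕ} {I : Fin k → Fin n} (hI : StrictMono I) :
    StrictMono (Fin.cons 0 (Fin.succ ∘ I) : Fin (k + 1) → Fin (n + 1)) := by
  intro a b hab
  induction a using Fin.cases with
  | zero =>
    induction b using Fin.cases with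
    | zero => exact absurd hab (lt_irrefl _)
    | succ b => simp
  | succ a =>
    induction b using Fin.cases with
    | zero => exact absurd hab (by simp)
    | succ b => simpa using hI (by simpa using hab)

lemma MinorsNonneg.schurZero {m n : ℕ} {A : Matrix (Fin (m + 1)) (Fin (n + 1)) ℝ}
    (hA : MinorsNonneg A) (h : 0 < A 0 0) : MinorsNonneg (schurZero A) := by
  intro k I J hI hJ
  have := hA _ _ _ (strictMono_cons_zero hI) (strictMono_cons_zero hJ)
  rw [det_submatrix_schurZero A h.ne'] at this
  exact nonneg_of_mul_nonneg_right this h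

lemma MinorsNonneg.zero_zero_pos {n : ℕ} {A : Matrix (Fin (n + 1)) (Fin (n + 1)) ℝ}
    (hA : MinorsNonneg A) (hdet : A.det ≠ 0) : 0 < A 0 0 := by
  refine (hA.entry_nonneg 0 0).lt_of_ne' fun h0 => ?_
  have hprod : ∀ i j : Fin n, A 0 j.succ * A i.succ 0 = 0 := by
    intro i j
    have hmono : ∀ i : Fin n, StrictMono ![0, i.succ] := by
      intro i a b hab
      fin_cases a <;> fin_cases b <;> simp_all
    have h := hA 2 ![0, i.succ] ![0, j.succ] (hmono i) (hmono j)
    rw [det_fin_two] at h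
    simp only [submatrix_apply, cons_val_zero, cons_val_one, h0, zero_mul, zero_sub] at h
    exact le_antisymm (by linarith) (mul_nonneg (hA.entry_nonneg _ _) (hA.entry_nonneg _ _))
  apply hdet
  by_cases hr : ∀ j : Fin n, A 0 j.succ = 0
  · exact det_eq_zero_of_row_eq_zero 0 fun j => Fin.cases h0 hr j
  · push Not at hr
    obtain ⟨j, hj⟩ := hr
    exact det_eq_zero_of_column_eq_zero 0 fun i =>
      Fin.cases h0 (fun i => (mul_eq_zero.mp (hprod i j)).resolve_left hj) i

lemma MinorsNonneg.det_castSucc_ne_zero {n : ℕ} {A : Matrix (Fin (n + 1)) (Fin (n + 1)) ℝ}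
    (hA : MinorsNonneg A) (hdet : A.det ≠ 0) :
    (A.submatrix Fin.castSucc Fin.castSucc).det ≠ 0 := by
  induction n with
  | zero => simp
  | succ n ih =>
    have hpos := hA.zero_zero_pos hdet
    have hB : (TotalPositivity.schurZero A).det ≠ 0 := fun h =>
      hdet (by rw [det_eq_mul_det_schurZero A hpos.ne', h, mul_zero])
    have hcons : (Fin.castSucc : Fin (n + 1) → Fin (n + 2)) =
        Fin.cons 0 (Fin.succ ∘ Fin.castSucc) := by
      funext i
      refine Fin.cases rfl (fun i => rfl) i
    rw [hcons, det_submatrix_schurZero A hpos.ne']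
    exact mul_ne_zero hpos.ne' (ih (hA.schurZero hpos) hB)

lemma MinorsNonneg.det_succ_ne_zero {n : ℕ} {A : Matrix (Fin (n + 1)) (Fin (n + 1)) ℝ}
    (hA : MinorsNonneg A) (hdet : A.det ≠ 0) :
    (A.submatrix Fin.succ Fin.succ).det ≠ 0 := by
  have h := hA.rev.det_castSucc_ne_zero (by
    rwa [show A.submatrix Fin.rev Fin.rev = A.submatrix Fin.revPerm Fin.revPerm from rfl,
      det_submatrix_equiv_self])
  rw [det_submatrix_rev] at h
  have hrev : Fin.rev ∘ Fin.castSucc ∘ Fin.rev = (Fin.succ : Fin n → Fin (n + 1)) := by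
    funext i
    simp [Fin.rev_castSucc]
  rwa [hrev] at h

lemma MinorsNonneg.det_consecutive_ne_zero {n : ℕ} {A : Matrix (Fin n) (Fin n) ℝ}
    (hA : MinorsNonneg A) (hdet : A.det ≠ 0) {k : ℕ} {I : Fin k → Fin n}
    (hI : Consecutive I) : (A.submatrix I I).det ≠ 0 := by
  induction n with
  | zero =>
    obtain rfl : k = 0 := by
      rcases Nat.eq_zero_or_pos k with h | h
      · exact h
      · exact (I ⟨0, h⟩).elim0
    simp
  | succ n ih =>
    by_cases hl : ∀ p, I p ≠ Fin.last n
    · have h := ih (hA.submatrix (Fin.strictMono_castSucc) (Fin.strictMono_castSucc))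
        (hA.det_castSucc_ne_zero hdet) (I := fun p => (I p).castPred (hl p))
        (fun p q => by simpa using hI p q)
      simpa [submatrix_submatrix, Function.comp_def] using h
    by_cases hz : ∀ p, I p ≠ 0
    · have h := ih (hA.submatrix (Fin.strictMono_succ) (Fin.strictMono_succ))
        (hA.det_succ_ne_zero hdet) (I := fun p => (I p).pred (hz p))
        (fun p q => by
          have h1 := hI p q
          have h2 := Fin.pos_iff_ne_zero.mpr (hz p)
          have h3 := Fin.pos_iff_ne_zero.mpr (hz q)
          simp only [Fin.lt_def, Fin.val_zero, Fin.val_pred] at *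
          omega)
      simpa [submatrix_submatrix, Function.comp_def] using h
    · push Not at hl hz
      obtain ⟨p, hp⟩ := hl
      obtain ⟨q, hq⟩ := hz
      have hpq := hI p q
      have hpk := p.isLt
      have hfirst := hI ⟨0, by omega⟩ q
      have hlast := hI ⟨k - 1, by omega⟩ q
      have := (I ⟨k - 1, by omega⟩).isLt
      rw [hp, hq] at hpq
      rw [hq] at hfirst hlast
      simp only [Fin.val_last, Fin.val_zero] at hpq hfirst hlast
      obtain rfl : k = n + 1 := by omega
      have hid : I = id := by
        funext r
        have := hI r q
        rw [hq] at this
        ext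
        simp only [Fin.val_zero, id] at this ⊢
        omega
      simpa [hid] using hdet

/-- A three-term Plücker relation, in two rows of a determinant. -/
lemma det_updateRow_plucker {ι : Type*} [Fintype ι] [DecidableEq ι] (M : Matrix ι ι ℝ)
    {i j : ι} (hij : i ≠ j) (e x r y : ι → ℝ)
    (h : ((M.updateRow i x).updateRow j r).det ≠ 0) :
    ((M.updateRow i x).updateRow j r).det * ((M.updateRow i e).updateRow j y).det +
      ((M.updateRow i e).updateRow j x).det * ((M.updateRow i r).updateRow j y).det =
    ((M.updateRow i e).updateRow j r).det * ((M.updateRow i x).updateRow j y).det := by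
  set N := (M.updateRow i x).updateRow j r with hN
  let F (a : ι → ℝ) : (ι → ℝ) →ₗ[ℝ] ℝ :=
    detRowAlternating.toMultilinearMap.toLinearMap (M.updateRow i a) j
  have hF : ∀ a b, F a b = ((M.updateRow i a).updateRow j b).det := fun a b => rfl
  let L : (ι → ℝ) →ₗ[ℝ] ℝ :=
    F x r • F e + F e x • F r - F e r • F x
  have hself : ∀ a, F a a = 0 := fun a => by
    rw [hF]
    refine det_zero_of_row_eq hij ?_
    simp [updateRow_ne hij]
  have hswap : ∀ a b, F a b = - F b a := fun a b => by
    have h1 := det_permute (Equiv.swap i j) ((M.updateRow i b).updateRow j a)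
    rw [Equiv.Perm.sign_swap hij] at h1
    rw [hF, hF, ← neg_one_mul]
    convert! h1 using 2
    · ext k l
      by_cases hkj : k = j
      · simp [hkj, hij]
      by_cases hki : k = i
      · simp [hki, hij]
      · simp [hkj, hki, Equiv.swap_apply_of_ne_of_ne hki hkj]
    · simp
  have hL : ∀ k, L (N k) = 0 := by
    intro k
    by_cases hkj : k = j
    · subst hkj
      simp [L, hN, hself]
      ring
    by_cases hki : k = i
    · subst hki
      simp [L, hN, hself, hkj, hswap r x]
      ring
    · have : ∀ a, F a (M k) = 0 := fun a => by
        rw [hF]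
        refine det_zero_of_row_eq hkj ?_
        simp [hkj, hki]
      simp [L, hN, hkj, hki, this]
  have hLy : L y = 0 := by
    have hy : y = (y ᵥ* N⁻¹) ᵥ* N := by
      rw [vecMul_vecMul, nonsing_inv_mul _ (isUnit_iff_ne_zero.mpr h), vecMul_one]
    rw [hy, vecMul_eq_sum, map_sum]
    simp [hL]
  simp only [L, LinearMap.sub_apply, LinearMap.add_apply, LinearMap.smul_apply, smul_eq_mul,
    hF] at hLy
  linarith

lemma strictMono_update_succ {k n : ℕ} {I : Fin (k + 1) → Fin n} (hI : StrictMono I)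
    {p : Fin k} {r : Fin n} (h1 : I p.castSucc < r) (h2 : r < I p.succ) :
    StrictMono (Function.update I p.succ r) := by
  rw [Fin.strictMono_iff_lt_succ]
  intro i
  have hi := hI (Fin.castSucc_lt_succ (i := i))
  simp only [Function.update_apply]
  split_ifs with h3 h4 h4
  · exact absurd (h3.trans h4.symm) (Fin.castSucc_lt_succ (i := i)).ne
  · exact h2.trans (h3 ▸ hi)
  · rwa [Fin.succ_injective _ h4]
  · exact hi

lemma strictMono_update_castSucc {k n : ℕ} {I : Fin (k + 1) → Fin n} (hI : StrictMono I)
    {p : Fin k} {r : Fin n} (h1 : I p.castSucc < r) (h2 : r < I p.succ) :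
    StrictMono (Function.update I p.castSucc r) := by
  rw [Fin.strictMono_iff_lt_succ]
  intro i
  have hi := hI (Fin.castSucc_lt_succ (i := i))
  simp only [Function.update_apply]
  split_ifs with h3 h4 h4
  · exact absurd (h3.trans h4.symm) (Fin.castSucc_lt_succ (i := i)).ne
  · rwa [Fin.castSucc_injective _ h3]
  · exact (h4 ▸ hi).trans h1
  · exact hi

lemma exists_gap_of_not_consecutive {k n : ℕ} {I : Fin (k + 1) → Fin n} (hI : StrictMono I)
    (h : ¬ Consecutive I) : ∃ p : Fin k, (I p.castSucc : ℕ) + 1 < I p.succ := by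
  by_contra! hgap
  have hval : ∀ p, (I p : ℕ) = I 0 + p := by
    intro p
    induction p using Fin.induction with
    | zero => simp
    | succ p ih =>
      have h1 : (I p.castSucc : ℕ) < I p.succ := hI (Fin.castSucc_lt_succ (i := p))
      have h2 := hgap p
      simp only [Fin.val_castSucc, Fin.val_succ] at *
      omega
  exact h fun p q => by rw [hval p, hval q]; omega

lemma det_updateRow_single_self {k : ℕ} (M : Matrix (Fin (k + 1)) (Fin (k + 1)) ℝ)
    (a : Fin (k + 1)) :
    (M.updateRow a (Pi.single a 1)).det = (M.submatrix a.succAbove a.succAbove).det := by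
  rw [← adjugate_apply, adjugate_fin_succ_eq_det_submatrix, ← two_mul, pow_mul]
  simp

/-- Positivity of all minors with column set `J` follows from positivity of those on consecutive
rows together with positivity of the smaller minors. -/
lemma MinorsNonneg.det_pos_of_consecutive_rows {n k : ℕ} {A : Matrix (Fin n) (Fin n) ℝ}
    (hA : MinorsNonneg A)
    (hsmall : ∀ I J : Fin k → Fin n, StrictMono I → StrictMono J → (∀ p, I p ≤ J p) →
      0 < (A.submatrix I J).det)
    {J : Fin (k + 1) → Fin n} (hJ : StrictMono J)
    (hcons : ∀ I : Fin (k + 1) → Fin n, StrictMono I → Consecutive I → (∀ p, I p ≤ J p) →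
      0 < (A.submatrix I J).det)
    (I : Fin (k + 1) → Fin n) (hI : StrictMono I) (hIJ : ∀ p, I p ≤ J p) :
    0 < (A.submatrix I J).det := by
  induction hs : ∑ p, (I p : ℕ) using Nat.strong_induction_on generalizing I with
  | _ s ih =>
  by_cases hc : Consecutive I
  · exact hcons I hI hc hIJ
  obtain ⟨p, hp⟩ := exists_gap_of_not_consecutive hI hc
  obtain ⟨r, hr1, hr2⟩ : ∃ r, I p.castSucc < r ∧ r < I p.succ :=
    ⟨⟨I p.castSucc + 1, hp.trans (I p.succ).isLt⟩, Nat.lt_succ_self _, hp⟩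
  have hne : p.castSucc ≠ p.succ := (Fin.castSucc_lt_succ (i := p)).ne
  have hupd : ∀ (I' : Fin (k + 1) → Fin n) a v, (A.submatrix I' J).updateRow a (fun c => A v (J c)) =
      A.submatrix (Function.update I' a v) J := by
    intro I' a v
    ext i c
    by_cases h : i = a <;> simp [updateRow_apply, h]
  have hxr : 0 < (A.submatrix (Function.update I p.succ r) J).det := by
    refine ih _ ?_ _ (strictMono_update_succ hI hr1 hr2) ?_ rfl
    · rw [← hs]
      refine Finset.sum_lt_sum (fun i _ => ?_) ⟨p.succ, Finset.mem_univ _, by simpa using hr2⟩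
      by_cases h : i = p.succ
      · subst h
        simpa using hr2.le
      · simp [h]
    · intro i
      by_cases h : i = p.succ
      · subst h
        simpa using hr2.le.trans (hIJ _)
      · simpa [h] using hIJ i
  have hry : 0 ≤ (A.submatrix (Function.update I p.castSucc r) J).det :=
    hA _ _ _ (strictMono_update_castSucc hI hr1 hr2) hJ
  have hey : 0 < ((A.submatrix I J).submatrix p.castSucc.succAbove p.castSucc.succAbove).det :=
    hsmall _ _ (hI.comp (Fin.strictMono_succAbove _)) (hJ.comp (Fin.strictMono_succAbove _))
      fun _ => hIJ _
  have hex : 0 ≤ ((A.submatrix (Function.update I p.succ (I p.castSucc)) J).submatrix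
      p.castSucc.succAbove p.castSucc.succAbove).det := by
    have hrows : Function.update I p.succ (I p.castSucc) ∘ p.castSucc.succAbove =
        I ∘ p.succ.succAbove := by
      funext q
      rcases lt_trichotomy q p with h | h | h
      · have h' : q.castSucc ≠ p.succ := by
          simp only [ne_eq, Fin.ext_iff, Fin.lt_def, Fin.val_castSucc, Fin.val_succ] at *
          omega
        simp [Fin.succAbove, h, h.le, h']
      · subst h
        simp
      · simp [Fin.succAbove, h.not_gt, h.not_ge, h.ne']
    rw [submatrix_submatrix, hrows]
    exact hA _ _ _ (hI.comp (Fin.strictMono_succAbove _)) (hJ.comp (Fin.strictMono_succAbove _))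
  have key := det_updateRow_plucker (A.submatrix I J) hne (Pi.single p.castSucc 1)
    (fun c => A (I p.castSucc) (J c)) (fun c => A r (J c)) (fun c => A (I p.succ) (J c))
  have hsingle : ∀ v, (((A.submatrix I J).updateRow p.castSucc (Pi.single p.castSucc 1)).updateRow
      p.succ (fun c => A v (J c))).det = ((A.submatrix (Function.update I p.succ v) J).submatrix
        p.castSucc.succAbove p.castSucc.succAbove).det := fun v => by
    rw [updateRow_comm _ hne, hupd, det_updateRow_single_self]
  simp only [hsingle, hupd, Function.update_eq_self] at key
  rw [Function.update_comm hne, Function.update_eq_self] at key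
  have key' := key hxr.ne'
  refine (hA _ _ _ hI hJ).lt_of_ne' fun h0 => ?_
  rw [h0, mul_zero] at key'
  linarith [mul_pos hxr hey, mul_nonneg hex hry]

lemma det_submatrix_antitranspose {n k : ℕ} (A : Matrix (Fin n) (Fin n) ℝ)
    (I J : Fin k → Fin n) :
    ((A.submatrix Fin.rev Fin.rev)ᵀ.submatrix I J).det =
      (A.submatrix (Fin.rev ∘ J ∘ Fin.rev) (Fin.rev ∘ I ∘ Fin.rev)).det := by
  rw [← transpose_submatrix, det_transpose, det_submatrix_rev]

lemma Consecutive.rev_conj {k n : ℕ} {I : Fin k → Fin n} (hI : Consecutive I) :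
    Consecutive (Fin.rev ∘ I ∘ Fin.rev) := by
  intro p q
  have h := hI p.rev q.rev
  have hp := (I p.rev).isLt
  have hq := (I q.rev).isLt
  simp only [Function.comp, Fin.val_rev] at *
  omega

/-- A Fekete-type criterion: for matrices with nonnegative minors, positivity of the minors
`I ≤ J` reduces to consecutive rows and columns. -/
lemma MinorsNonneg.det_pos_of_consecutive {n : ℕ} {A : Matrix (Fin n) (Fin n) ℝ}
    (hA : MinorsNonneg A)
    (hcons : ∀ (k : ℕ) (I J : Fin k → Fin n), Consecutive I → Consecutive J →
      (∀ p, I p ≤ J p) → 0 < (A.submatrix I J).det)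
    (k : ℕ) (I J : Fin k → Fin n) (hI : StrictMono I) (hJ : StrictMono J)
    (hIJ : ∀ p, I p ≤ J p) : 0 < (A.submatrix I J).det := by
  induction k with
  | zero => simp
  | succ k ih =>
    refine hA.det_pos_of_consecutive_rows ih hJ (fun I hI hIc hIJ => ?_) I hI hIJ
    have hrevrev : ∀ K : Fin (k + 1) → Fin n,
        Fin.rev ∘ (Fin.rev ∘ K ∘ Fin.rev) ∘ Fin.rev = K := fun K => by
      funext p
      simp
    have h := hA.rev.transpose.det_pos_of_consecutive_rows
      (fun I' J' hI' hJ' h => by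
        rw [det_submatrix_antitranspose]
        exact ih _ _ (strictMono_rev_conj hJ') (strictMono_rev_conj hI')
          fun p => Fin.rev_le_rev.mpr (h _))
      (strictMono_rev_conj hI)
      (fun J' hJ' hJc h => by
        rw [det_submatrix_antitranspose, hrevrev]
        exact hcons _ _ _ hIc (Consecutive.rev_conj hJc)
          fun p => by simpa using Fin.rev_le_rev.mpr (h p.rev))
      (Fin.rev ∘ J ∘ Fin.rev) (strictMono_rev_conj hJ) fun p => Fin.rev_le_rev.mpr (hIJ _)
    rwa [det_submatrix_antitranspose, hrevrev, hrevrev] at h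

lemma exists_le_le_perm_apply {k : ℕ} (σ : Equiv.Perm (Fin k)) (p : Fin k) :
    ∃ q, q ≤ p ∧ p ≤ σ q := by
  by_contra! h
  have h1 : (Finset.Iic p).card ≤ (Finset.Iio p).card :=
    Finset.card_le_card_of_injOn σ (fun q hq => by simpa using h q (by simpa using hq))
      σ.injective.injOn
  simp at h1

lemma UTUnipotent.det_submatrix_eq_zero {d k : ℕ} {u : Matrix (Fin d) (Fin d) ℝ}
    (hu : UTUnipotent u) {I J : Fin k → Fin d} (hI : StrictMono I) (hJ : StrictMono J)
    {p : Fin k} (hp : J p < I p) : (u.submatrix I J).det = 0 := by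
  rw [det_apply]
  refine Finset.sum_eq_zero fun σ _ => ?_
  obtain ⟨q, hqp, hpq⟩ := exists_le_le_perm_apply σ p
  rw [Finset.prod_eq_zero (Finset.mem_univ q), smul_zero]
  exact hu.1 _ _ ((hJ.monotone hqp).trans_lt (hp.trans_le (hI.monotone hpq)))

lemma UTUnipotent.minorsNonneg {d : ℕ} {u : Matrix (Fin d) (Fin d) ℝ}
    (hu : UTUnipotent u) (h : TotallyNonneg u) : MinorsNonneg u := by
  intro k I J hI hJ
  rcases Nat.eq_zero_or_pos k with rfl | hk
  · simp
  by_cases hIJ : ∀ p, I p ≤ J p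
  · exact h k hk (by simpa using Fintype.card_le_of_injective I hI.injective) I J hI hJ hIJ
  · push Not at hIJ
    obtain ⟨p, hp⟩ := hIJ
    exact (UTUnipotent.det_submatrix_eq_zero hu hI hJ hp).ge

lemma UTUnipotent.det_eq_one {d : ℕ} {u : Matrix (Fin d) (Fin d) ℝ}
    (hu : UTUnipotent u) : u.det = 1 := by
  rw [det_of_isUpperTriangular (fun i j h => hu.1 i j h)]
  simp [hu.2]

/-- A totally nonnegative unipotent matrix with nonzero corner minors is totally positive. -/
lemma UTUnipotent.totallyPositive {d : ℕ} {u : Matrix (Fin d) (Fin d) ℝ}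
    (hu : UTUnipotent u) (h : TotallyNonneg u)
    (hcorner : ∀ (k : ℕ) (hk : k ≤ d), 1 ≤ k → k ≤ d - 1 →
      (u.submatrix (cornerI k hk) (cornerJ k hk)).det ≠ 0) :
    TotallyPositive u := by
  have hA := UTUnipotent.minorsNonneg hu h
  have hcorner' : ∀ m (hm : m ≤ d), (u.submatrix (cornerI m hm) (cornerJ m hm)).det ≠ 0 := by
    intro m hm
    rcases Nat.eq_zero_or_pos m with rfl | hpos
    · simp
    rcases hm.lt_or_eq with hlt | rfl
    · exact hcorner m hm hpos (by omega)
    · have hI : cornerI m hm = id := rfl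
      have hJ : cornerJ m hm = id := by
        funext p
        ext
        simp [cornerJ]
      rw [hI, hJ, submatrix_id_id, UTUnipotent.det_eq_one hu]
      exact one_ne_zero
  intro k _ _ I J hI hJ hIJ
  refine hA.det_pos_of_consecutive (fun k I J hI hJ hIJ => ?_) k I J hI hJ hIJ
  rcases Nat.eq_zero_or_pos k with rfl | hk
  · simp
  have hstrict : ∀ K : Fin k → Fin d, Consecutive K → StrictMono K := fun K hK a b hab => by
    have := hK a b
    rw [Fin.lt_def] at hab ⊢
    omega
  refine (hA k I J (hstrict I hI) (hstrict J hJ)).lt_of_ne' ?_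
  set z : Fin k := ⟨0, hk⟩ with hz
  have hz0 : (z : ℕ) = 0 := rfl
  have hle : (I z : ℕ) ≤ J z := hIJ z
  set s : ℕ := J z - I z with hs
  have hJI : ∀ p, (J p : ℕ) = I p + s := fun p => by
    have h1 := hI p z
    have h2 := hJ p z
    omega
  have hlt : ∀ p, (I p : ℕ) < d - s := fun p => by
    have := hJI p
    have := (J p).isLt
    omega
  have hm : d - s ≤ d := Nat.sub_le _ _
  have hC : MinorsNonneg (u.submatrix (cornerI (d - s) hm) (cornerJ (d - s) hm)) :=
    hA.submatrix (fun a b hab => hab) (fun a b hab => Nat.add_lt_add_left hab _)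
  have hmain := hC.det_consecutive_ne_zero (hcorner' _ hm) (I := fun p => ⟨I p, hlt p⟩)
    (fun p q => hI p q)
  rw [submatrix_submatrix] at hmain
  convert! hmain using 3
  funext p
  ext
  have := hJI p
  have := hlt p
  simp only [cornerJ, Function.comp]
  omega

lemma continuous_minor {d k : ℕ} (I J : Fin k → Fin d) :
    Continuous fun u : Matrix (Fin d) (Fin d) ℝ => (u.submatrix I J).det :=
  (continuous_id.matrix_submatrix I J).matrix_det

lemma isClosed_totallyNonneg (d : ℕ) :
    IsClosed {u : Matrix (Fin d) (Fin d) ℝ | TotallyNonneg u} := by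
  simp only [TotallyNonneg, Set.ofPred_forall]
  repeat refine isClosed_iInter fun _ => ?_
  exact isClosed_le continuous_const (continuous_minor _ _)

lemma isOpen_totallyPositive (d : ℕ) :
    IsOpen {u : Matrix (Fin d) (Fin d) ℝ | TotallyPositive u} := by
  have h : {u : Matrix (Fin d) (Fin d) ℝ | TotallyPositive u} =
      ⋂ k : Fin (d + 1), {u | 1 ≤ (k : ℕ) → ∀ I J : Fin k → Fin d,
        StrictMono I → StrictMono J → (∀ p, I p ≤ J p) → 0 < (u.submatrix I J).det} := by
    ext u
    simp only [Set.mem_ofPred_eq, Set.mem_iInter]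
    exact ⟨fun h k hk => h k hk (Nat.le_of_lt_succ k.isLt),
      fun h k hk hkd => h ⟨k, Nat.lt_succ_of_le hkd⟩ hk⟩
  rw [h]
  simp only [Set.ofPred_forall]
  repeat refine isOpen_iInter_of_finite fun _ => ?_
  exact isOpen_lt continuous_const (continuous_minor _ _)

end TotalPositivity

open TotalPositivity

/-- Let `u : [0,1] → Mat_d(ℝ)` be a continuous path of upper
triangular unipotent matrices such that `u 0` is totally positive and, for
every `t ∈ [0,1]` and every `1 ≤ k ≤ d - 1`, the top-right corner `k × k`
minor of `u t` is nonzero. Then `u 1` is totally positive. -/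
theorem totallyPositive_of_path {d : ℕ}
    (u : ℝ → Matrix (Fin d) (Fin d) ℝ)
    (hcont : ContinuousOn u (Set.Icc (0 : ℝ) 1))
    (huni : ∀ t ∈ Set.Icc (0 : ℝ) 1, UTUnipotent (u t))
    (h0 : TotallyPositive (u 0))
    (hcorner : ∀ t ∈ Set.Icc (0 : ℝ) 1, ∀ (k : ℕ) (_ : 1 ≤ k) (h2 : k ≤ d - 1),
      ((u t).submatrix (cornerI k (by omega)) (cornerJ k (by omega))).det ≠ 0) :
    TotallyPositive (u 1) := by
  have hclosed : IsClosed ({t | TotallyPositive (u t)} ∩ Set.Icc (0 : ℝ) 1) := by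
    convert! hcont.preimage_isClosed_of_isClosed isClosed_Icc (isClosed_totallyNonneg d) using 1
    ext t
    constructor
    · rintro ⟨h, ht⟩
      exact ⟨ht, fun k hk hkd I J hI hJ hIJ => (h k hk hkd I J hI hJ hIJ).le⟩
    · rintro ⟨ht, h⟩
      exact ⟨UTUnipotent.totallyPositive (huni t ht) h fun k _ => hcorner t ht k, ht⟩
  refine hclosed.Icc_subset_of_forall_mem_nhdsWithin h0 (fun t ht => ?_)
    (Set.right_mem_Icc.mpr zero_le_one)
  have hmem : {t | TotallyPositive (u t)} ∈ nhdsWithin t (Set.Icc 0 1) :=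
    hcont t ⟨ht.2.1, ht.2.2.le⟩ ((isOpen_totallyPositive d).mem_nhds ht.1)
  exact nhdsWithin_le_of_mem (Icc_mem_nhdsGT_of_mem ht.2) hmem
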